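/- Let (Ω, F, P) be a non-atomic probability space, let k ≥ 1 be a natural number, and let X, X₁, …, X_k be nonnegative measurable functions on Ω with P(X ≠ 0) ≤ 1/k and X_i ~ X for each i. Let λ₁, …, λ_k ≥ 0 satisfy Σ_{i=1}^k λ_i = 1. Then for every s ∈ [0,1], sup{ ∫_A X dP : A ∈ F, P(A) ≤ s/k } ≤ sup{ ∫_B (Σ_{i=1}^k λ_i X_i) dP : B ∈ F, P(B) ≤ s }, where the integrals are taken in the extended nonnegative reals. -/

import Mathlib

open MeasureTheory ProbabilityTheory
open scoped ENNReal

/-- A measure is nonatomic if every measurable set of positive measure admits a measurable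
subset of strictly smaller positive measure. -/
def Nonatomic {Ω : Type*} [MeasurableSpace Ω] (μ : Measure Ω) : Prop :=
  ∀ s : Set Ω, MeasurableSet s → 0 < μ s →
    ∃ t, t ⊆ s ∧ MeasurableSet t ∧ 0 < μ t ∧ μ t < μ s

theorem Nonatomic.exists_subset_measureReal_pos_le {Ω : Type*} [MeasurableSpace Ω]
    {μ : Measure Ω} [IsFiniteMeasure μ] (hμ : Nonatomic μ) {s : Set Ω} (hs : MeasurableSet s)
    (hpos : 0 < μ.real s) {ε : ℝ} (hε : 0 < ε) :
    ∃ t, t ⊆ s ∧ MeasurableSet t ∧ 0 < μ.real t ∧ μ.real t ≤ ε := by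
  have halving (n : ℕ) :
      ∃ t, t ⊆ s ∧ MeasurableSet t ∧ 0 < μ.real t ∧ μ.real t ≤ μ.real s * (1 / 2) ^ n := by
    induction n with
    | zero => exact ⟨s, subset_rfl, hs, hpos, by simp⟩
    | succ n ih =>
      obtain ⟨t, hts, htm, ht0, ht⟩ := ih
      obtain ⟨u, hut, hum, hu0, hu⟩ := hμ t htm (ENNReal.toReal_pos_iff.1 ht0).1
      have hu0' : 0 < μ.real u := ENNReal.toReal_pos hu0.ne' (measure_ne_top μ u)
      have hu' : μ.real u < μ.real t :=
        (ENNReal.toReal_lt_toReal (measure_ne_top μ u) (measure_ne_top μ t)).2 hu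
      have hdiff : μ.real (t \ u) = μ.real t - μ.real u := measureReal_sdiff hut hum
      rw [pow_succ]
      rcases le_total (μ.real u) (μ.real t / 2) with h | h
      · exact ⟨u, hut.trans hts, hum, hu0', by linarith⟩
      · exact ⟨t \ u, Set.sdiff_subset.trans hts, htm.diff hum, by linarith, by linarith⟩
  obtain ⟨n, hn⟩ := exists_pow_lt_of_lt_one (div_pos hε hpos) (by norm_num : (1 / 2 : ℝ) < 1)
  obtain ⟨t, hts, htm, ht0, ht⟩ := halving n
  refine ⟨t, hts, htm, ht0, ht.trans ?_⟩
  rw [lt_div_iff₀ hpos] at hn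
  linarith

/-- Sierpiński's theorem: a finite nonatomic measure takes all intermediate values. -/
theorem Nonatomic.exists_subset_measureReal_eq {Ω : Type*} [MeasurableSpace Ω]
    {μ : Measure Ω} [IsFiniteMeasure μ] (hμ : Nonatomic μ) {s : Set Ω} (hs : MeasurableSet s)
    {a : ℝ} (ha0 : 0 ≤ a) (ha : a ≤ μ.real s) :
    ∃ t, t ⊆ s ∧ MeasurableSet t ∧ μ.real t = a := by
  let F : Type _ := {t : Set Ω // t ⊆ s ∧ MeasurableSet t ∧ μ.real t ≤ a}
  have step (t : F) : ∃ u : F, t.1 ⊆ u.1 ∧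
      ∀ v : F, t.1 ⊆ v.1 → μ.real v.1 + μ.real t.1 ≤ 2 * μ.real u.1 := by
    by_contra! hne
    have hbdd : BddAbove (Set.range fun v : {v : F // t.1 ⊆ v.1} ↦ μ.real v.1.1) :=
      ⟨a, by rintro _ ⟨v, rfl⟩; exact v.1.2.2.2⟩
    have hlt : μ.real t.1 < ⨆ v : {v : F // t.1 ⊆ v.1}, μ.real v.1.1 := by
      obtain ⟨v, htv, hv⟩ := hne t subset_rfl
      have := le_ciSup hbdd ⟨v, htv⟩
      dsimp only at this
      linarith
    have : Nonempty {v : F // t.1 ⊆ v.1} := ⟨⟨t, subset_rfl⟩⟩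
    obtain ⟨u, hu⟩ := exists_lt_of_lt_ciSup (add_div_two_lt_right.2 hlt)
    obtain ⟨v, htv, hv⟩ := hne u.1 u.2
    have := le_ciSup hbdd ⟨v, htv⟩
    dsimp only at this
    linarith
  choose next hsub hnext using step
  let f (n : ℕ) : F := next^[n] ⟨∅, Set.empty_subset s, .empty, by simpa using ha0⟩
  have hf (n : ℕ) : f (n + 1) = next (f n) := Function.iterate_succ_apply' _ _ _
  have hmono : Monotone fun n ↦ (f n).1 :=
    monotone_nat_of_le_succ fun n ↦ by rw [hf]; exact hsub _
  set T := ⋃ n, (f n).1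
  have hTs : T ⊆ s := Set.iUnion_subset fun n ↦ (f n).2.1
  have hTm : MeasurableSet T := .iUnion fun n ↦ (f n).2.2.1
  have hlim : Filter.Tendsto (fun n ↦ μ.real (f n).1) Filter.atTop (nhds (μ.real T)) :=
    (ENNReal.tendsto_toReal (measure_ne_top μ T)).comp (tendsto_measure_iUnion_atTop hmono)
  have hTa : μ.real T ≤ a := le_of_tendsto' hlim fun n ↦ (f n).2.2.2
  refine ⟨T, hTs, hTm, hTa.antisymm ?_⟩
  by_contra! hlt
  have hdiff : μ.real (s \ T) = μ.real s - μ.real T := measureReal_sdiff hTs hTm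
  obtain ⟨e, hes, hem, he0, he⟩ := hμ.exists_subset_measureReal_pos_le (hs.diff hTm)
    (by linarith) (sub_pos.2 hlt)
  have hunion : μ.real (T ∪ e) = μ.real T + μ.real e :=
    measureReal_union (Set.disjoint_sdiff_right.mono_right hes) hem
  have hTe (n : ℕ) : μ.real (T ∪ e) + μ.real (f n).1 ≤ 2 * μ.real T := by
    refine (hnext (f n) ⟨T ∪ e, Set.union_subset hTs (hes.trans Set.sdiff_subset),
      hTm.union hem, by linarith⟩ ?_).trans ?_
    · exact (Set.subset_iUnion (fun n ↦ (f n).1) n).trans Set.subset_union_left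
    · rw [← hf]
      have := measureReal_mono (μ := μ) (Set.subset_iUnion (fun n ↦ (f n).1) (n + 1))
      linarith
  have := le_of_tendsto' (hlim.const_add (μ.real (T ∪ e))) hTe
  linarith

/-- A nonnegative random variable has an upper quantile of every level `t ∈ (0, 1]`. -/
theorem exists_nonneg_measureReal_lt_le_le {Ω : Type*} [MeasurableSpace Ω]
    (μ : Measure Ω) [IsProbabilityMeasure μ] {Y : Ω → ℝ} (hYm : Measurable Y)
    (hY0 : ∀ ω, 0 ≤ Y ω) {t : ℝ} (ht0 : 0 < t) (ht1 : t ≤ 1) :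
    ∃ c, 0 ≤ c ∧ μ.real {ω | c < Y ω} ≤ t ∧ t ≤ μ.real {ω | c ≤ Y ω} := by
  have hm (c : ℝ) : MeasurableSet {ω | c < Y ω} := measurableSet_lt measurable_const hYm
  let S : Set ℝ := {c | 0 ≤ c ∧ μ.real {ω | c < Y ω} ≤ t}
  have hbdd : BddBelow S := ⟨0, fun c hc ↦ hc.1⟩
  have hne : S.Nonempty := by
    have hanti : Antitone fun n : ℕ ↦ {ω | (n : ℝ) < Y ω} :=
      fun m n hmn ω (hω : (n : ℝ) < Y ω) ↦
        show (m : ℝ) < Y ω from lt_of_le_of_lt (Nat.cast_le.2 hmn) hω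
    have hempty : ⋂ n : ℕ, {ω | (n : ℝ) < Y ω} = ∅ := by
      ext ω
      simpa using exists_nat_ge (Y ω)
    have hlim := (ENNReal.tendsto_toReal (measure_ne_top μ _)).comp (tendsto_measure_iInter_atTop
      (fun n : ℕ ↦ (hm n).nullMeasurableSet) hanti ⟨0, measure_ne_top μ _⟩)
    rw [hempty, measure_empty] at hlim
    obtain ⟨n, hn⟩ := (hlim.eventually (gt_mem_nhds ht0)).exists
    exact ⟨n, Nat.cast_nonneg n, hn.le⟩
  have hc0 : 0 ≤ sInf S := le_csInf hne fun c hc ↦ hc.1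
  obtain ⟨δ, hδanti, hδpos, hδlim⟩ := exists_seq_strictAnti_tendsto (0 : ℝ)
  refine ⟨sInf S, hc0, ?_, ?_⟩
  · have hmono : Monotone fun n ↦ {ω | sInf S + δ n < Y ω} := fun m n hmn ω hω ↦
      lt_of_le_of_lt (add_le_add_right (hδanti.antitone hmn) _) hω
    have hunion : ⋃ n, {ω | sInf S + δ n < Y ω} = {ω | sInf S < Y ω} := by
      ext ω
      simp only [Set.mem_iUnion, Set.mem_ofPred_eq]
      refine ⟨fun ⟨n, hn⟩ ↦ by linarith [hδpos n], fun h ↦ ?_⟩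
      obtain ⟨n, hn⟩ := (hδlim.eventually (gt_mem_nhds (sub_pos.2 h))).exists
      exact ⟨n, by linarith⟩
    have hlim := (ENNReal.tendsto_toReal (measure_ne_top μ _)).comp
      (tendsto_measure_iUnion_atTop (μ := μ) hmono)
    rw [hunion] at hlim
    refine le_of_tendsto' hlim fun n ↦ ?_
    obtain ⟨c, hc, hcn⟩ := exists_lt_of_csInf_lt hne (lt_add_of_pos_right (sInf S) (hδpos n))
    exact (measureReal_mono fun ω hω ↦ hcn.trans hω).trans hc.2
  · rcases hc0.eq_or_lt with h0 | h0
    · simpa [← h0, hY0] using ht1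
    have hanti : Antitone fun n ↦ {ω | sInf S - δ n < Y ω} := fun m n hmn ω hω ↦
      lt_of_le_of_lt (sub_le_sub_left (hδanti.antitone hmn) _) hω
    have hinter : ⋂ n, {ω | sInf S - δ n < Y ω} = {ω | sInf S ≤ Y ω} := by
      ext ω
      simp only [Set.mem_iInter, Set.mem_ofPred_eq]
      refine ⟨fun h ↦ ?_, fun h n ↦ by linarith [hδpos n]⟩
      have := le_of_tendsto' (hδlim.const_sub (sInf S)) fun n ↦ (h n).le
      simpa using this
    have hlim := (ENNReal.tendsto_toReal (measure_ne_top μ _)).comp (tendsto_measure_iInter_atTop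
      (fun n ↦ (hm (sInf S - δ n)).nullMeasurableSet) hanti ⟨0, measure_ne_top μ _⟩)
    rw [hinter] at hlim
    refine ge_of_tendsto hlim ?_
    filter_upwards [hδlim.eventually (gt_mem_nhds h0)] with n hn
    by_contra! hlt
    have := csInf_le hbdd (show sInf S - δ n ∈ S from ⟨by linarith, hlt.le⟩)
    linarith [hδpos n]

/-- On a nonatomic space, an integral over a set of measure at most `t` is dominated by the
integral of any equidistributed function over a suitable set of measure at most `t`. -/
theorem Nonatomic.exists_setLIntegral_le {Ω : Type*} [MeasurableSpace Ω]
    {P : Measure Ω} [IsProbabilityMeasure P] (hP : Nonatomic P) {X Y : Ω → ℝ}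
    (hYm : Measurable Y) (hY0 : ∀ ω, 0 ≤ Y ω)
    (hXY : IdentDistrib Y X P P) {t : ℝ} (ht0 : 0 ≤ t) (ht1 : t ≤ 1) {A : Set Ω}
    (hPA : P A ≤ ENNReal.ofReal t) :
    ∃ B, MeasurableSet B ∧ P B ≤ ENNReal.ofReal t ∧
      ∫⁻ ω in A, ENNReal.ofReal (X ω) ∂P ≤ ∫⁻ ω in B, ENNReal.ofReal (Y ω) ∂P := by
  rcases ht0.eq_or_lt with rfl | ht
  · refine ⟨∅, .empty, by simp, ?_⟩
    rw [setLIntegral_measure_zero A _ (by simpa using hPA)]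
    exact zero_le
  obtain ⟨c, hc0, hlt, hle⟩ := exists_nonneg_measureReal_lt_le_le P hYm hY0 ht ht1
  have hm : MeasurableSet {ω | c < Y ω} := measurableSet_lt measurable_const hYm
  have hsplit : {ω | c ≤ Y ω} = {ω | c < Y ω} ∪ {ω | Y ω = c} := by
    ext ω
    simp [le_iff_lt_or_eq, eq_comm]
  have hdisj : Disjoint {ω | c < Y ω} {ω | Y ω = c} :=
    Set.disjoint_left.2 fun ω h h' ↦ h.ne' h'
  have hm' : MeasurableSet {ω | Y ω = c} := measurableSet_eq_fun hYm measurable_const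
  rw [hsplit, measureReal_union hdisj hm'] at hle
  obtain ⟨C, hCs, hCm, hC⟩ := hP.exists_subset_measureReal_eq hm'
    (sub_nonneg.2 hlt) (sub_le_iff_le_add'.2 hle)
  have hB : P ({ω | c < Y ω} ∪ C) = ENNReal.ofReal t := by
    rw [← ofReal_measureReal, measureReal_union (hdisj.mono_right hCs) hCm, hC,
      add_sub_cancel]
  refine ⟨{ω | c < Y ω} ∪ C, hm.union hCm, hB.le, ?_⟩
  have hpos : Measurable fun x : ℝ ↦ ENNReal.ofReal (x - c) := by fun_prop
  calc ∫⁻ ω in A, ENNReal.ofReal (X ω) ∂P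
      ≤ ∫⁻ ω in A, (ENNReal.ofReal (X ω - c) + ENNReal.ofReal c) ∂P :=
        lintegral_mono fun ω ↦ by simpa using ENNReal.ofReal_add_le (p := X ω - c) (q := c)
    _ = ∫⁻ ω in A, ENNReal.ofReal (X ω - c) ∂P + ENNReal.ofReal c * P A := by
        rw [lintegral_add_right _ measurable_const, setLIntegral_const]
    _ ≤ ∫⁻ ω, ENNReal.ofReal (X ω - c) ∂P + ENNReal.ofReal c * ENNReal.ofReal t := by
        exact add_le_add (setLIntegral_le_lintegral _ _) (mul_le_mul' le_rfl hPA)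
    _ = ∫⁻ ω, ENNReal.ofReal (Y ω - c) ∂P + ENNReal.ofReal c * P ({ω | c < Y ω} ∪ C) := by
        rw [hB]
        congr 1
        exact (hXY.comp hpos).lintegral_eq.symm
    _ = ∫⁻ ω in {ω | c < Y ω} ∪ C, ENNReal.ofReal (Y ω - c) ∂P
          + ENNReal.ofReal c * P ({ω | c < Y ω} ∪ C) := by
        rw [setLIntegral_eq_of_support_subset]
        intro ω hω
        left
        simpa using hω
    _ = ∫⁻ ω in {ω | c < Y ω} ∪ C, (ENNReal.ofReal (Y ω - c) + ENNReal.ofReal c) ∂P := by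
        rw [lintegral_add_right _ measurable_const, setLIntegral_const]
    _ = ∫⁻ ω in {ω | c < Y ω} ∪ C, ENNReal.ofReal (Y ω) ∂P := by
        refine setLIntegral_congr_fun (hm.union hCm) fun ω hω ↦ ?_
        have hcY : c ≤ Y ω := by
          rcases hω with h | h
          · exact le_of_lt h
          · exact (hCs h).ge
        rw [← ENNReal.ofReal_add (sub_nonneg.2 hcY) hc0, sub_add_cancel]

/-- Hardy–Littlewood majorization: if `P(X ≠ 0) ≤ 1/k` and `Xᵢ ~ X`, then for every
`s ∈ [0,1]`,
`sup {∫_A X : P(A) ≤ s/k} ≤ sup {∫_B Σ λᵢ Xᵢ : P(B) ≤ s}`. -/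
theorem hardyLittlewood_majorization
    {Ω : Type*} [MeasurableSpace Ω] (P : Measure Ω) [IsProbabilityMeasure P]
    (hP : Nonatomic P) (k : ℕ) (hk : 1 ≤ k)
    (X : Ω → ℝ) (hXm : Measurable X) (hX0 : ∀ ω, 0 ≤ X ω)
    (hXsupp : P {ω | X ω ≠ 0} ≤ 1 / (k : ℝ≥0∞))
    (Xi : Fin k → Ω → ℝ) (hXim : ∀ i, Measurable (Xi i)) (hXi0 : ∀ i ω, 0 ≤ Xi i ω)
    (hXi : ∀ i, IdentDistrib (Xi i) X P P)
    (lam : Fin k → ℝ) (hlam0 : ∀ i, 0 ≤ lam i) (hlam : ∑ i, lam i = 1)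
    (s : ℝ) (hs : s ∈ Set.Icc (0 : ℝ) 1) :
    (⨆ (A : Set Ω) (_ : MeasurableSet A) (_ : P A ≤ ENNReal.ofReal (s / k)),
        ∫⁻ ω in A, ENNReal.ofReal (X ω) ∂P) ≤
      ⨆ (B : Set Ω) (_ : MeasurableSet B) (_ : P B ≤ ENNReal.ofReal s),
        ∫⁻ ω in B, ENNReal.ofReal (∑ i, lam i * Xi i ω) ∂P := by
  have hk0 : (0 : ℝ) < k := by exact_mod_cast hk
  have hk1 : (1 : ℝ) ≤ k := by exact_mod_cast hk
  have ht0 : 0 ≤ s / k := div_nonneg hs.1 hk0.le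
  have ht1 : s / k ≤ 1 := (div_le_one hk0).2 (hs.2.trans hk1)
  refine iSup_le fun A ↦ iSup_le fun _ ↦ iSup_le fun hPA ↦ ?_
  choose B hBm hPB hB using fun i ↦
    hP.exists_setLIntegral_le (hXim i) (hXi0 i) (hXi i) ht0 ht1 hPA
  have hPU : P (⋃ i, B i) ≤ ENNReal.ofReal s := by
    calc P (⋃ i, B i) ≤ ∑ i, P (B i) := measure_iUnion_fintype_le P B
      _ ≤ ∑ _i : Fin k, ENNReal.ofReal (s / k) := Finset.sum_le_sum fun i _ ↦ hPB i
      _ = ENNReal.ofReal s := by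
        rw [← ENNReal.ofReal_sum_of_nonneg fun _ _ ↦ ht0]
        congr 1
        simp
        field_simp
  refine le_iSup_of_le (⋃ i, B i) (le_iSup_of_le (.iUnion hBm) (le_iSup_of_le hPU ?_))
  have hsum (ω : Ω) : ENNReal.ofReal (∑ i, lam i * Xi i ω) =
      ∑ i, ENNReal.ofReal (lam i) * ENNReal.ofReal (Xi i ω) := by
    rw [ENNReal.ofReal_sum_of_nonneg fun i _ ↦ mul_nonneg (hlam0 i) (hXi0 i ω)]
    simp_rw [ENNReal.ofReal_mul (hlam0 _)]
  calc ∫⁻ ω in A, ENNReal.ofReal (X ω) ∂P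
      = ∑ i, ENNReal.ofReal (lam i) * ∫⁻ ω in A, ENNReal.ofReal (X ω) ∂P := by
        rw [← Finset.sum_mul, ← ENNReal.ofReal_sum_of_nonneg fun i _ ↦ hlam0 i, hlam,
          ENNReal.ofReal_one, one_mul]
    _ ≤ ∑ i, ENNReal.ofReal (lam i) * ∫⁻ ω in ⋃ i, B i, ENNReal.ofReal (Xi i ω) ∂P := by
        refine Finset.sum_le_sum fun i _ ↦ mul_le_mul' le_rfl ?_
        exact (hB i).trans (lintegral_mono_set (Set.subset_iUnion B i))
    _ = ∫⁻ ω in ⋃ i, B i, ENNReal.ofReal (∑ i, lam i * Xi i ω) ∂P := by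
        simp_rw [hsum]
        rw [lintegral_finsetSum _ fun i _ ↦ by fun_prop]
        simp_rw [lintegral_const_mul _ (hXim _).ennreal_ofReal]
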